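/- There exist a finite connected simple graph G, a vertex coloring C of G, and a consistent subset S of (G,C) such that no subset of S is a consistent subset of (G,C) of minimum cardinality (i.e., every subset of S that is a consistent subset has cardinality strictly greater than the minimum cardinality of a consistent subset of (G,C)). -/

import Mathlib

open SimpleGraph

/-- Distance from a vertex to a set of vertices. -/
noncomputable def setDist {V : Type*} (G : SimpleGraph V) (v : V) (U : Set V) : ℕ :=
  sInf ((G.dist v) '' U)

/-- `v` is covered by `U`: some nearest neighbor of `v` in `U` has the same color. -/
def Covered {V Col : Type*} (G : SimpleGraph V) (C : V → Col) (v : V) (U : Set V) : Prop :=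
  ∃ u ∈ U, G.dist v u = setDist G v U ∧ C u = C v

/-- `S` is a consistent subset of `(G, C)`. -/
def ConsistentSubset {V Col : Type*} (G : SimpleGraph V) (C : V → Col) (S : Set V) : Prop :=
  S.Nonempty ∧ ∀ v, Covered G C v S

/-- A set covers `v` iff it has a nearest neighbor of `v` of the same color. -/
theorem covered_iff {V Col : Type*} {G : SimpleGraph V} {C : V → Col} {v : V} {U : Set V} :
    Covered G C v U ↔ ∃ u ∈ U, (∀ w ∈ U, G.dist v u ≤ G.dist v w) ∧ C u = C v := by
  refine exists_congr fun u => and_congr_right fun hu => and_congr_left fun _ => ?_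
  constructor
  · intro h w hw
    exact h ▸ Nat.sInf_le (Set.mem_image_of_mem _ hw)
  · intro h
    refine le_antisymm ?_ (Nat.sInf_le (Set.mem_image_of_mem _ hu))
    refine le_csInf ⟨_, Set.mem_image_of_mem _ hu⟩ ?_
    rintro _ ⟨w, hw, rfl⟩
    exact h w hw

/-- The star on four vertices with center `0`. -/
def clawGraph : SimpleGraph (Fin 4) where
  Adj u v := u ≠ v ∧ (u = 0 ∨ v = 0)
  symm := ⟨fun _ _ h => ⟨h.1.symm, h.2.symm⟩⟩
  loopless := ⟨fun _ h => h.1 rfl⟩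

/-- The coloring of the claw giving the center and the leaf `1` one color, and the leaves
`2` and `3` the other. -/
def clawColor : Fin 4 → Fin 2 := ![1, 1, 0, 0]

theorem clawGraph_connected : clawGraph.Connected := by
  have h (v : Fin 4) : clawGraph.Reachable 0 v := by
    by_cases hv : v = 0
    · rw [hv]
    · exact Adj.reachable (G := clawGraph) ⟨Ne.symm hv, Or.inl rfl⟩
  exact (connected_iff _).2 ⟨fun u v => (h u).symm.trans (h v), ⟨0⟩⟩

theorem clawGraph_dist (u v : Fin 4) :
    clawGraph.dist u v = if u = v then 0 else if u = 0 ∨ v = 0 then 1 else 2 := by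
  split_ifs with h h'
  · rw [h, dist_self]
  · exact dist_eq_one_iff_adj.2 ⟨h, h'⟩
  · push Not at h'
    have hle : clawGraph.dist u v ≤ 2 :=
      dist_le (.cons (v := 0) ⟨h'.1, Or.inr rfl⟩
        (.cons ⟨h'.2.symm, Or.inl rfl⟩ .nil) : clawGraph.Walk u v)
    have h0 : clawGraph.dist u v ≠ 0 := fun h0 => h (clawGraph_connected.dist_eq_zero_iff.1 h0)
    have h1 : clawGraph.dist u v ≠ 1 := fun h1 =>
      (dist_eq_one_iff_adj.1 h1).2.elim h'.1 h'.2
    omega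

theorem claw_consistentSubset_center :
    ConsistentSubset clawGraph clawColor {0, 2, 3} := by
  refine ⟨⟨0, by simp⟩, fun v => covered_iff.2 ?_⟩
  simp only [clawGraph_dist, Set.mem_insert_iff, Set.mem_singleton_iff]
  revert v
  decide

theorem claw_consistentSubset_leaves :
    ConsistentSubset clawGraph clawColor {1, 2} := by
  refine ⟨⟨1, by simp⟩, fun v => covered_iff.2 ?_⟩
  simp only [clawGraph_dist, Set.mem_insert_iff, Set.mem_singleton_iff]
  revert v
  decide

theorem claw_eq_of_subset_of_consistentSubset {S : Set (Fin 4)} (hS : S ⊆ {0, 2, 3})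
    (h : ConsistentSubset clawGraph clawColor S) : S = {0, 2, 3} := by
  have hcov v := covered_iff.1 (h.2 v)
  simp only [clawGraph_dist] at hcov
  have h0 : (0 : Fin 4) ∈ S := by
    obtain ⟨u, hu, -, hc⟩ := hcov 0
    rcases hS hu with rfl | rfl | rfl
    · exact hu
    all_goals simp [clawColor] at hc
  refine hS.antisymm ?_
  intro v hv
  obtain ⟨u, hu, hmin, hc⟩ := hcov v
  have hmin := hmin 0 h0
  rcases hv with rfl | rfl | rfl <;> rcases hS hu with rfl | rfl | rfl <;> first
    | exact hu
    | exact absurd hmin (by decide)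
    | exact absurd hc (by decide)

/-- There are a finite connected graph `G`, a coloring `C`, and a consistent
subset `S` of `(G, C)` such that no subset of `S` is a minimum consistent subset: every
subset of `S` that is consistent is strictly larger than the minimum size of a consistent
subset. -/
theorem statement13 :
    ∃ (n k : ℕ) (G : SimpleGraph (Fin n)) (C : Fin n → Fin k) (S : Set (Fin n)),
      G.Connected ∧ ConsistentSubset G C S ∧
      ∀ S' ⊆ S, ConsistentSubset G C S' →
        sInf {m | ∃ S'' : Set (Fin n), ConsistentSubset G C S'' ∧ S''.ncard = m}
          < S'.ncard := by
  refine ⟨4, 2, clawGraph, clawColor, {0, 2, 3}, clawGraph_connected,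
    claw_consistentSubset_center, fun S hS h => ?_⟩
  rw [claw_eq_of_subset_of_consistentSubset hS h]
  have hle := Nat.sInf_le (s := {m | ∃ S, ConsistentSubset clawGraph clawColor S ∧ S.ncard = m})
    ⟨_, claw_consistentSubset_leaves, rfl⟩
  refine hle.trans_lt ?_
  simp [Set.ncard_eq_toFinset_card']
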